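/- arXiv:math/0612718 — 2 statements merged into one kernel-verified Lean document; each statement's English description precedes it below -/
import Mathlib

section
/- The constant θ_d := inf{ liminf_n n^{1/d} ∫_{[0,1]^d} dist(x, Σ_n) dx : Σ_n ⊆ [0,1]^d, #Σ_n ≤ n } satisfies 0 < θ_d < ∞ for every dimension d ≥ 1. -/
open MeasureTheory Filter Topology ENNReal

/-- The unit cube `[0,1]^d`. -/
def unitCube (d : ℕ) : Set (EuclideanSpace ℝ (Fin d)) :=
  {x | ∀ i, x i ∈ Set.Icc (0 : ℝ) 1}

/-- The constant `θ_d`, defined as the infimum over all sequences of (nonempty) finite sets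
`Σ_n ⊆ [0,1]^d` with `#Σ_n ≤ n` of `liminf_n n^{1/d} ∫_{[0,1]^d} dist(x, Σ_n) dx`. -/
noncomputable def theta (d : ℕ) : ℝ≥0∞ :=
  ⨅ (S : ℕ → Finset (EuclideanSpace ℝ (Fin d)))
    (_ : ∀ n : ℕ, 1 ≤ n → (S n : Set (EuclideanSpace ℝ (Fin d))) ⊆ unitCube d ∧
      (S n).Nonempty ∧ (S n).card ≤ n),
    Filter.liminf (fun n : ℕ => (n : ℝ≥0∞) ^ ((1 : ℝ) / d) *
      ∫⁻ x in unitCube d, EMetric.infEdist x (S n : Set (EuclideanSpace ℝ (Fin d)))) Filter.atTop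

theorem volume_unitCube (d : ℕ) : volume (unitCube d) = 1 := by
  have h := (EuclideanSpace.volume_preserving_symm_measurableEquiv_toLp
    (Fin d)).measure_preimage_equiv (Set.Icc (0 : Fin d → ℝ) 1)
  rw [Real.volume_Icc_pi] at h
  simp only [Pi.one_apply, Pi.zero_apply, sub_zero, ENNReal.ofReal_one, Finset.prod_const_one] at h
  rw [← h]
  congr 1
  ext x
  simp [unitCube, Pi.le_def, forall_and]

/-- Any `n` points leave at least half of the cube at distance of order `n ^ (-1 / d)`. -/
theorem exists_pos_le_rpow_mul_lintegral_infEDist (d : ℕ) (hd : 1 ≤ d) :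
    ∃ c : ℝ≥0∞, 0 < c ∧ ∀ n : ℕ, 1 ≤ n → ∀ T : Finset (EuclideanSpace ℝ (Fin d)), T.card ≤ n →
      c ≤ (n : ℝ≥0∞) ^ ((1 : ℝ) / d) *
        ∫⁻ x in unitCube d, Metric.infEDist x (T : Set (EuclideanSpace ℝ (Fin d))) := by
  set V : ℝ := (volume (Metric.ball (0 : EuclideanSpace ℝ (Fin d)) 1)).toReal with hV
  have hV_top : volume (Metric.ball (0 : EuclideanSpace ℝ (Fin d)) 1) ≠ ⊤ :=
    measure_ball_lt_top.ne
  have hVpos : 0 < V :=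
    ENNReal.toReal_pos (Metric.measure_ball_pos volume _ one_pos).ne' hV_top
  obtain ⟨c, hc0, hc1, hcV⟩ : ∃ c : ℝ, 0 < c ∧ c ≤ 1 ∧ c * V ≤ 1 / 2 := by
    refine ⟨min 1 (1 / (2 * V)), by positivity, min_le_left _ _, ?_⟩
    calc min 1 (1 / (2 * V)) * V ≤ 1 / (2 * V) * V := by gcongr; exact min_le_right _ _
      _ = 1 / 2 := by field_simp
  refine ⟨ENNReal.ofReal (c / 2), by positivity, fun n hn T hT => ?_⟩
  have hn0 : (0 : ℝ) < n := by exact_mod_cast hn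
  set a : ℝ := (n : ℝ) ^ ((1 : ℝ) / d) with ha
  have ha0 : 0 < a := by positivity
  have had : a ^ d = n := by
    rw [ha, one_div, Real.rpow_inv_natCast_pow hn0.le (by omega)]
  set r : ℝ := c / a with hr
  have hr0 : 0 < r := by positivity
  have hball : ∀ s : EuclideanSpace ℝ (Fin d),
      volume (Metric.ball s r) = ENNReal.ofReal (r ^ d * V) := by
    intro s
    rw [Measure.addHaar_ball_of_pos volume s hr0, finrank_euclideanSpace_fin,
      ENNReal.ofReal_mul (by positivity), hV, ENNReal.ofReal_toReal hV_top]
  have hcover : unitCube d ⊆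
      ({x | ENNReal.ofReal r ≤ Metric.infEDist x (T : Set (EuclideanSpace ℝ (Fin d)))} ∩
        unitCube d) ∪ ⋃ s ∈ T, Metric.ball s r := by
    intro x hx
    by_cases h : ENNReal.ofReal r ≤ Metric.infEDist x (T : Set (EuclideanSpace ℝ (Fin d)))
    · exact Or.inl ⟨h, hx⟩
    · right
      rw [not_le, Metric.infEDist_lt_iff] at h
      obtain ⟨s, hs, hxs⟩ := h
      rw [edist_dist, ENNReal.ofReal_lt_ofReal_iff hr0] at hxs
      simp only [Set.mem_iUnion]
      exact ⟨s, hs, hxs⟩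
  have hmeas : MeasurableSet
      {x | ENNReal.ofReal r ≤ Metric.infEDist x (T : Set (EuclideanSpace ℝ (Fin d)))} :=
    measurableSet_le measurable_const measurable_infEDist
  have hunion : volume (⋃ s ∈ T, Metric.ball s r) ≤ ENNReal.ofReal (1 / 2) := by
    refine (measure_biUnion_finset_le T _).trans ?_
    simp only [hball, Finset.sum_const, nsmul_eq_mul]
    rw [← ENNReal.ofReal_natCast, ← ENNReal.ofReal_mul (by positivity)]
    apply ENNReal.ofReal_le_ofReal
    have hTn : (T.card : ℝ) ≤ n := by exact_mod_cast hT
    calc (T.card : ℝ) * (r ^ d * V) ≤ n * (r ^ d * V) := by gcongr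
      _ = c ^ d * V := by rw [hr, div_pow, had]; field_simp
      _ ≤ c * V := by gcongr; exact pow_le_of_le_one hc0.le hc1 (by omega)
      _ ≤ 1 / 2 := hcV
  have hhalf : ENNReal.ofReal (1 / 2) ≤ volume.restrict (unitCube d)
      {x | ENNReal.ofReal r ≤ Metric.infEDist x (T : Set (EuclideanSpace ℝ (Fin d)))} := by
    rw [Measure.restrict_apply hmeas]
    have h := (measure_mono hcover).trans (measure_union_le (μ := volume) _ _)
    rw [volume_unitCube] at h
    have h2 := h.trans (add_le_add_right hunion _)
    have h3 : (1 : ℝ≥0∞) = ENNReal.ofReal (1 / 2) + ENNReal.ofReal (1 / 2) := by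
      rw [← ENNReal.ofReal_add (by norm_num) (by norm_num)]; norm_num
    rw [h3] at h2
    exact (ENNReal.add_le_add_iff_right ENNReal.ofReal_ne_top).1 h2
  calc ENNReal.ofReal (c / 2)
      = (n : ℝ≥0∞) ^ ((1 : ℝ) / d) * (ENNReal.ofReal r * ENNReal.ofReal (1 / 2)) := by
        rw [← ENNReal.ofReal_natCast, ENNReal.ofReal_rpow_of_pos hn0, ← ha,
          ← ENNReal.ofReal_mul hr0.le, ← ENNReal.ofReal_mul ha0.le, hr]
        congr 1
        field_simp
    _ ≤ _ := by
        gcongr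
        refine le_trans ?_ (mul_meas_ge_le_lintegral measurable_infEDist (ENNReal.ofReal r))
        gcongr

/-- Regular grids of at most `n` points are within distance of order `n ^ (-1 / d)` of every
point of the cube. -/
theorem exists_finset_rpow_mul_infEDist_le (d : ℕ) (hd : 1 ≤ d) (n : ℕ) (hn : 1 ≤ n) :
    ∃ T : Finset (EuclideanSpace ℝ (Fin d)),
      ((T : Set (EuclideanSpace ℝ (Fin d))) ⊆ unitCube d ∧ T.Nonempty ∧ T.card ≤ n) ∧
      ∀ x ∈ unitCube d, (n : ℝ≥0∞) ^ ((1 : ℝ) / d) *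
        Metric.infEDist x (T : Set (EuclideanSpace ℝ (Fin d))) ≤ ENNReal.ofReal (2 * d) := by
  classical
  have hn1 : (1 : ℝ) ≤ n := by exact_mod_cast hn
  have hn0 : (0 : ℝ) < n := by linarith
  set a : ℝ := (n : ℝ) ^ ((1 : ℝ) / d) with ha
  have ha1 : 1 ≤ a := Real.one_le_rpow hn1 (by positivity)
  have had : a ^ d = n := by
    rw [ha, one_div, Real.rpow_inv_natCast_pow hn0.le (by omega)]
  set k : ℕ := ⌊a⌋₊ with hk
  have hk1 : 1 ≤ k := Nat.le_floor (by simpa using ha1)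
  have hk1' : (1 : ℝ) ≤ k := by exact_mod_cast hk1
  have hk0 : (0 : ℝ) < k := by linarith
  have hka : (k : ℝ) ≤ a := Nat.floor_le (by linarith)
  have hak : a ≤ 2 * k := by
    have := Nat.lt_floor_add_one a
    linarith
  have hkn : k ^ d ≤ n := by
    have : (k : ℝ) ^ d ≤ n := had ▸ pow_le_pow_left₀ hk0.le hka d
    exact_mod_cast this
  let g : (Fin d → Fin k) → EuclideanSpace ℝ (Fin d) :=
    fun v => WithLp.toLp 2 fun j => ((v j : ℕ) : ℝ) / k
  have : Nonempty (Fin k) := ⟨⟨0, hk1⟩⟩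
  refine ⟨Finset.univ.image g, ⟨?_, Finset.univ_nonempty.image g, ?_⟩, fun x hx => ?_⟩
  · intro y hy
    simp only [Finset.coe_image, Finset.coe_univ, Set.image_univ, Set.mem_range] at hy
    obtain ⟨v, rfl⟩ := hy
    intro j
    have h : ((v j : ℕ) : ℝ) ≤ k := by exact_mod_cast (v j).2.le
    exact ⟨by positivity, (div_le_one hk0).2 h⟩
  · exact Finset.card_image_le.trans (by simpa using hkn)
  · let v : Fin d → Fin k := fun j => ⟨min ⌊k * x j⌋₊ (k - 1), by omega⟩
    have hcoord : ∀ j, dist (x j) (g v j) ≤ 1 / k := by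
      intro j
      obtain ⟨h0, h1⟩ := hx j
      change |x j - ((min ⌊k * x j⌋₊ (k - 1) : ℕ) : ℝ) / k| ≤ 1 / k
      have hx_eq : x j = (k * x j) / k := by field_simp
      rw [hx_eq, ← sub_div, abs_div, abs_of_pos hk0, ← hx_eq]
      gcongr
      have hf1 := Nat.floor_le (mul_nonneg hk0.le h0)
      have hf2 := Nat.lt_floor_add_one (k * x j)
      have hle : k * x j ≤ k := by nlinarith
      rw [abs_le]
      rcases min_choice ⌊k * x j⌋₊ (k - 1) with h | h <;> rw [h]
      · constructor <;> linarith
      · have hmin : k - 1 ≤ ⌊k * x j⌋₊ := by omega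
        have hmin' : ((k - 1 : ℕ) : ℝ) ≤ (⌊k * x j⌋₊ : ℝ) := by exact_mod_cast hmin
        rw [Nat.cast_sub hk1, Nat.cast_one] at hmin' ⊢
        constructor <;> linarith
    have hdist : dist x (g v) ≤ d / k := by
      rw [EuclideanSpace.dist_eq]
      apply Real.sqrt_le_iff.2 ⟨by positivity, ?_⟩
      have hd1 : (1 : ℝ) ≤ d := by exact_mod_cast hd
      calc ∑ j, dist (x j) (g v j) ^ 2 ≤ ∑ _j : Fin d, (1 / (k : ℝ)) ^ 2 := by
            gcongr with j; exact hcoord j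
        _ = d * (1 / (k : ℝ)) ^ 2 := by simp
        _ ≤ (d * d) * (1 / (k : ℝ)) ^ 2 := by gcongr; nlinarith
        _ = (d / k : ℝ) ^ 2 := by ring
    calc (n : ℝ≥0∞) ^ ((1 : ℝ) / d) * Metric.infEDist x _
        ≤ (n : ℝ≥0∞) ^ ((1 : ℝ) / d) * edist x (g v) := by
          gcongr
          exact Metric.infEDist_le_edist_of_mem (by simp)
      _ = ENNReal.ofReal (a * dist x (g v)) := by
          rw [← ENNReal.ofReal_natCast, ENNReal.ofReal_rpow_of_pos hn0, ← ha, edist_dist,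
            ENNReal.ofReal_mul (by linarith)]
      _ ≤ ENNReal.ofReal (2 * d) := by
          apply ENNReal.ofReal_le_ofReal
          calc a * dist x (g v) ≤ (2 * k) * (d / k) := by gcongr
            _ = 2 * d := by field_simp

theorem stmt6 (d : ℕ) (hd : 1 ≤ d) : 0 < theta d ∧ theta d < ⊤ := by
  constructor
  · obtain ⟨c, hc, h⟩ := exists_pos_le_rpow_mul_lintegral_infEDist d hd
    refine hc.trans_le (le_iInf₂ fun S hS => ?_)
    refine le_liminf_of_le (by isBoundedDefault) ?_
    filter_upwards [eventually_ge_atTop 1] with n hn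
    exact h n hn (S n) (hS n hn).2.2
  · choose! S hS hle using exists_finset_rpow_mul_infEDist_le d hd
    refine (iInf₂_le S hS).trans_lt (lt_of_le_of_lt ?_ (ENNReal.ofReal_lt_top (r := 2 * d)))
    refine (liminf_le_limsup (by isBoundedDefault) (by isBoundedDefault)).trans
      (limsup_le_of_le (by isBoundedDefault) ?_)
    filter_upwards [eventually_ge_atTop 1] with n hn
    change (n : ℝ≥0∞) ^ ((1 : ℝ) / d) * ∫⁻ x in unitCube d, Metric.infEDist x (S n) ≤ _
    rw [← lintegral_const_mul _ measurable_infEDist]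
    refine (setLIntegral_mono measurable_const (hle n hn)).trans ?_
    rw [setLIntegral_const, volume_unitCube, mul_one]
end

section
/- Let Ω = [0,1], ν = 𝓛¹ restricted to [0,1], let Σ'_k ⊆ [0,1] with #Σ'_k = k, and define the decrement of an interval Δ of the partition induced by Σ'_k as δ(Δ) := |Δ|²/8 if Δ is internal and δ(Δ) := |Δ|²/3 if Δ is external. If Σ'_{k+1} minimizes F over {Σ : Σ'_k ⊆ Σ ⊆ [0,1], #Σ ≤ k+1} and F(Σ'_{k+1}) < F(Σ'_k), then Σ'_{k+1} = Σ'_k ∪ {x}, where x lies in optimal position inside an interval Δ_p whose decrement δ(Δ_p) is maximal among all intervals of the partition, and F(Σ'_{k+1}) = F(Σ'_k) − max_q δ(Δ_q). -/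
open MeasureTheory Filter Topology
open scoped Classical

/-- The average-distance functional `F(Σ) = ∫_0^1 dist(x, Σ) dx` for a finite `Σ ⊆ [0,1]`. -/
noncomputable def F1 (s : Finset ℝ) : ℝ :=
  ∫ x in Set.Icc (0 : ℝ) 1, Metric.infDist x (s : Set ℝ)

/-- The set of decrements `δ(Δ)` of the intervals `Δ` of the partition of `[0,1]` induced by
`s`: `|Δ|²/8` for internal intervals and `|Δ|²/3` for the two external intervals. -/
def decrements (s : Finset ℝ) : Set ℝ :=
  {l | ∃ a ∈ s, ∃ b ∈ s, a < b ∧ (∀ y ∈ s, y ∉ Set.Ioo a b) ∧ l = (b - a) ^ 2 / 8} ∪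
  {l | ∃ a ∈ s, (∀ y ∈ s, a ≤ y) ∧ l = a ^ 2 / 3} ∪
  {l | ∃ b ∈ s, (∀ y ∈ s, y ≤ b) ∧ l = (1 - b) ^ 2 / 3}

/-- The maximal decrement over all intervals of the partition induced by `s`. -/
noncomputable def maxDec (s : Finset ℝ) : ℝ := sSup (decrements s)

theorem infDist_eq_of_forall_le {s : Set ℝ} {y z : ℝ} (hz : z ∈ s)
    (h : ∀ w ∈ s, |y - z| ≤ |y - w|) : Metric.infDist y s = |y - z| :=
  le_antisymm (Metric.infDist_le_dist_of_mem hz) ((Metric.le_infDist ⟨z, hz⟩).2 fun w hw => h w hw)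

theorem infDist_insert_of_le {s : Finset ℝ} {x y z : ℝ} (hz : z ∈ s) (h : |y - z| ≤ |y - x|) :
    Metric.infDist y ((insert x s : Finset ℝ) : Set ℝ) = Metric.infDist y (s : Set ℝ) := by
  have hne : (s : Set ℝ).Nonempty := ⟨z, hz⟩
  refine le_antisymm (Metric.infDist_le_infDist_of_subset (by simp) hne) ?_
  refine (Metric.le_infDist ⟨x, by simp⟩).2 fun w hw => ?_
  rcases Finset.mem_insert.1 (Finset.mem_coe.1 hw) with rfl | hw
  · exact (Metric.infDist_le_dist_of_mem hz).trans h
  · exact Metric.infDist_le_dist_of_mem hw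

theorem intervalIntegrable_infDist (s : Set ℝ) (a b : ℝ) :
    IntervalIntegrable (fun y => Metric.infDist y s) volume a b :=
  (Metric.continuous_infDist_pt s).intervalIntegrable a b

theorem F1_eq_add (s : Finset ℝ) (a b : ℝ) :
    F1 s = (∫ y in (0 : ℝ)..a, Metric.infDist y (s : Set ℝ)) +
      (∫ y in a..b, Metric.infDist y (s : Set ℝ)) +
      ∫ y in b..1, Metric.infDist y (s : Set ℝ) := by
  rw [intervalIntegral.integral_add_adjacent_intervals,
    intervalIntegral.integral_add_adjacent_intervals,
    intervalIntegral.integral_of_le zero_le_one, F1, integral_Icc_eq_integral_Ioc] <;>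
  exact intervalIntegrable_infDist _ _ _

theorem integral_sub_left (a b : ℝ) : ∫ y in a..b, (y - a) = (b - a) ^ 2 / 2 := by
  rw [intervalIntegral.integral_sub (by simp) (by simp), integral_id,
    intervalIntegral.integral_const, smul_eq_mul]
  ring

theorem integral_sub_right (a b : ℝ) : ∫ y in a..b, (b - y) = (b - a) ^ 2 / 2 := by
  rw [intervalIntegral.integral_sub (by simp) (by simp), integral_id,
    intervalIntegral.integral_const, smul_eq_mul]
  ring

theorem integral_infDist_right {s : Finset ℝ} {a m : ℝ} (ha : a ∈ s) (ham : a ≤ m)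
    (h : ∀ w ∈ s, w ≤ a ∨ 2 * m - a ≤ w) :
    ∫ y in a..m, Metric.infDist y (s : Set ℝ) = (m - a) ^ 2 / 2 := by
  rw [← integral_sub_left]
  refine intervalIntegral.integral_congr fun y hy => ?_
  rw [Set.uIcc_of_le ham] at hy
  obtain ⟨h1, h2⟩ := hy
  have e : |y - a| = y - a := abs_of_nonneg (by linarith)
  rw [← e]
  refine infDist_eq_of_forall_le ha fun w hw => ?_
  rw [e]
  rcases h w hw with h | h
  · exact le_trans (by linarith) (le_abs_self _)
  · exact le_trans (by linarith) (neg_le_abs _)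

theorem integral_infDist_left {s : Finset ℝ} {b m : ℝ} (hb : b ∈ s) (hmb : m ≤ b)
    (h : ∀ w ∈ s, b ≤ w ∨ w ≤ 2 * m - b) :
    ∫ y in m..b, Metric.infDist y (s : Set ℝ) = (b - m) ^ 2 / 2 := by
  rw [← integral_sub_right]
  refine intervalIntegral.integral_congr fun y hy => ?_
  rw [Set.uIcc_of_le hmb] at hy
  obtain ⟨h1, h2⟩ := hy
  have e : |y - b| = b - y := by rw [abs_sub_comm]; exact abs_of_nonneg (by linarith)
  rw [← e]
  refine infDist_eq_of_forall_le hb fun w hw => ?_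
  rw [e]
  rcases h w hw with h | h
  · exact le_trans (by linarith) (neg_le_abs _)
  · exact le_trans (by linarith) (le_abs_self _)

theorem integral_infDist_internal {s : Finset ℝ} {a b : ℝ} (ha : a ∈ s) (hb : b ∈ s) (hab : a ≤ b)
    (h : ∀ w ∈ s, w ≤ a ∨ b ≤ w) :
    ∫ y in a..b, Metric.infDist y (s : Set ℝ) = (b - a) ^ 2 / 4 := by
  rw [← intervalIntegral.integral_add_adjacent_intervals
      (intervalIntegrable_infDist _ a ((a + b) / 2)) (intervalIntegrable_infDist _ _ b),
    integral_infDist_right ha (by linarith), integral_infDist_left hb (by linarith)]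
  · ring
  · intro w hw
    rcases h w hw with h | h
    · right; linarith
    · left; exact h
  · intro w hw
    rcases h w hw with h | h
    · left; exact h
    · right; linarith

theorem integral_infDist_insert_of_le {s : Finset ℝ} {x a c d : ℝ} (ha : a ∈ s) (hax : a ≤ x)
    (hca : c ≤ a) (hda : d ≤ a) :
    ∫ y in c..d, Metric.infDist y ((insert x s : Finset ℝ) : Set ℝ) =
      ∫ y in c..d, Metric.infDist y (s : Set ℝ) := by
  refine intervalIntegral.integral_congr fun y hy => infDist_insert_of_le ha ?_
  have hy' : y ≤ a := hy.2.trans (max_le hca hda)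
  rw [abs_of_nonpos (by linarith), abs_of_nonpos (by linarith)]
  linarith

theorem integral_infDist_insert_of_ge {s : Finset ℝ} {x b c d : ℝ} (hb : b ∈ s) (hxb : x ≤ b)
    (hbc : b ≤ c) (hbd : b ≤ d) :
    ∫ y in c..d, Metric.infDist y ((insert x s : Finset ℝ) : Set ℝ) =
      ∫ y in c..d, Metric.infDist y (s : Set ℝ) := by
  refine intervalIntegral.integral_congr fun y hy => infDist_insert_of_le hb ?_
  have hy' : b ≤ y := (le_min hbc hbd).trans hy.1
  rw [abs_of_nonneg (by linarith), abs_of_nonneg (by linarith)]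
  linarith

theorem F1_insert_internal {s : Finset ℝ} (hs : (s : Set ℝ) ⊆ Set.Icc (0 : ℝ) 1) {a b x : ℝ}
    (ha : a ∈ s) (hb : b ∈ s) (hax : a ≤ x) (hxb : x ≤ b) (h : ∀ w ∈ s, w ≤ a ∨ b ≤ w) :
    F1 (insert x s) = F1 s - (x - a) * (b - x) / 2 := by
  have ha0 := (hs ha).1
  have hb1 := (hs hb).2
  rw [F1_eq_add s a b, F1_eq_add (insert x s) a b,
    integral_infDist_insert_of_le ha hax ha0 le_rfl,
    integral_infDist_insert_of_ge hb hxb le_rfl hb1,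
    integral_infDist_internal ha hb (hax.trans hxb) h,
    ← intervalIntegral.integral_add_adjacent_intervals
      (intervalIntegrable_infDist _ a x) (intervalIntegrable_infDist _ x b),
    integral_infDist_internal (Finset.mem_insert_of_mem ha) (Finset.mem_insert_self x s) hax,
    integral_infDist_internal (Finset.mem_insert_self x s) (Finset.mem_insert_of_mem hb) hxb]
  · ring
  · intro w hw
    rcases Finset.mem_insert.1 hw with rfl | hw
    · left; exact le_rfl
    · exact (h w hw).imp_left fun h => h.trans hax
  · intro w hw
    rcases Finset.mem_insert.1 hw with rfl | hw
    · right; exact le_rfl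
    · exact (h w hw).imp_right fun h => hxb.trans h

theorem F1_insert_left {s : Finset ℝ} (hs : (s : Set ℝ) ⊆ Set.Icc (0 : ℝ) 1) {a x : ℝ}
    (ha : a ∈ s) (hx : 0 ≤ x) (hxa : x ≤ a) (h : ∀ w ∈ s, a ≤ w) :
    F1 (insert x s) = F1 s - (a ^ 2 / 3 - 3 / 4 * (x - a / 3) ^ 2) := by
  have ha1 := (hs ha).2
  rw [F1_eq_add s 0 a, F1_eq_add (insert x s) x a,
    integral_infDist_insert_of_ge ha hxa le_rfl ha1,
    integral_infDist_left ha (hx.trans hxa) fun w hw => Or.inl (h w hw),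
    integral_infDist_left (Finset.mem_insert_self x s) hx,
    integral_infDist_internal (Finset.mem_insert_self x s) (Finset.mem_insert_of_mem ha) hxa,
    intervalIntegral.integral_same]
  · ring
  · intro w hw
    rcases Finset.mem_insert.1 hw with rfl | hw
    · left; exact le_rfl
    · right; exact h w hw
  · intro w hw
    rcases Finset.mem_insert.1 hw with rfl | hw
    · left; exact le_rfl
    · left; exact hxa.trans (h w hw)

theorem F1_insert_right {s : Finset ℝ} (hs : (s : Set ℝ) ⊆ Set.Icc (0 : ℝ) 1) {b x : ℝ}
    (hb : b ∈ s) (hbx : b ≤ x) (hx : x ≤ 1) (h : ∀ w ∈ s, w ≤ b) :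
    F1 (insert x s) = F1 s - ((1 - b) ^ 2 / 3 - 3 / 4 * (x - (2 + b) / 3) ^ 2) := by
  have hb0 := (hs hb).1
  rw [F1_eq_add s b 1, F1_eq_add (insert x s) b x,
    integral_infDist_insert_of_le hb hbx hb0 le_rfl,
    integral_infDist_right hb (hbx.trans hx) fun w hw => Or.inl (h w hw),
    integral_infDist_right (Finset.mem_insert_self x s) hx,
    integral_infDist_internal (Finset.mem_insert_of_mem hb) (Finset.mem_insert_self x s) hbx,
    intervalIntegral.integral_same]
  · ring
  · intro w hw
    rcases Finset.mem_insert.1 hw with rfl | hw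
    · right; exact le_rfl
    · left; exact h w hw
  · intro w hw
    rcases Finset.mem_insert.1 hw with rfl | hw
    · left; exact le_rfl
    · left; exact (h w hw).trans hbx

theorem exists_F1_insert_eq_sub_decrement {s : Finset ℝ}
    (hs : (s : Set ℝ) ⊆ Set.Icc (0 : ℝ) 1) {l : ℝ} (hl : l ∈ decrements s) :
    ∃ x ∈ Set.Icc (0 : ℝ) 1, F1 (insert x s) = F1 s - l := by
  rcases hl with (⟨a, ha, b, hb, hab, h, rfl⟩ | ⟨a, ha, h, rfl⟩) | ⟨b, hb, h, rfl⟩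
  · have ha0 := (hs ha).1
    have hb1 := (hs hb).2
    refine ⟨(a + b) / 2, ⟨by linarith, by linarith⟩, ?_⟩
    rw [F1_insert_internal hs ha hb (by linarith) (by linarith)]
    · ring
    · intro w hw
      by_contra! hc
      exact h w hw hc
  · obtain ⟨ha0, ha1⟩ := hs ha
    refine ⟨a / 3, ⟨by linarith, by linarith⟩, ?_⟩
    rw [F1_insert_left hs ha (by linarith) (by linarith) h]
    ring
  · obtain ⟨hb0, hb1⟩ := hs hb
    refine ⟨(2 + b) / 3, ⟨by linarith, by linarith⟩, ?_⟩
    rw [F1_insert_right hs hb (by linarith) (by linarith) h]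
    ring

theorem stmt13 (k : ℕ) (hk : 1 ≤ k) (s t : Finset ℝ)
    (hs : (s : Set ℝ) ⊆ Set.Icc (0 : ℝ) 1) (hcard : s.card = k)
    (hst : s ⊆ t) (hts : (t : Set ℝ) ⊆ Set.Icc (0 : ℝ) 1) (htcard : t.card ≤ k + 1)
    (hmin : ∀ u : Finset ℝ, s ⊆ u → (u : Set ℝ) ⊆ Set.Icc (0 : ℝ) 1 → u.card ≤ k + 1 →
      F1 t ≤ F1 u)
    (hdecr : F1 t < F1 s) :
    ∃ x : ℝ, x ∉ s ∧ t = insert x s ∧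
      ((∃ a ∈ s, ∃ b ∈ s, a < b ∧ (∀ y ∈ s, y ∉ Set.Ioo a b) ∧ x = (a + b) / 2 ∧
          (b - a) ^ 2 / 8 = maxDec s) ∨
       (∃ a ∈ s, (∀ y ∈ s, a ≤ y) ∧ x = a / 3 ∧ a ^ 2 / 3 = maxDec s) ∨
       (∃ b ∈ s, (∀ y ∈ s, y ≤ b) ∧ x = (2 + b) / 3 ∧ (1 - b) ^ 2 / 3 = maxDec s)) ∧
      F1 t = F1 s - maxDec s := by
  have hne : s.Nonempty := Finset.card_pos.1 (by omega)
  have hsub : s ≠ t := by rintro rfl; exact lt_irrefl _ hdecr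
  have hlt : s.card < t.card := Finset.card_lt_card (hst.ssubset_of_ne hsub)
  obtain ⟨x, hx, rfl⟩ := Finset.exists_eq_insert_iff.2 ⟨hst, by omega⟩
  obtain ⟨hx0, hx1⟩ : x ∈ Set.Icc (0 : ℝ) 1 := hts (by simp)
  have hub : ∀ l ∈ decrements s, l ≤ F1 s - F1 (insert x s) := by
    intro l hl
    obtain ⟨z, hz, hFz⟩ := exists_F1_insert_eq_sub_decrement hs hl
    have := hmin (insert z s) (Finset.subset_insert z s)
      (by rw [Finset.coe_insert]; exact Set.insert_subset hz hs)
      ((Finset.card_insert_le z s).trans (by omega))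
    linarith
  have hmax : ∀ l ∈ decrements s, F1 s - F1 (insert x s) = l → l = maxDec s := by
    intro l hl h
    exact (IsGreatest.csSup_eq ⟨hl, fun m hm => (hub m hm).trans h.le⟩).symm
  refine ⟨x, hx, rfl, ?_⟩
  by_cases hlo : ∃ y ∈ s, y < x
  · by_cases hhi : ∃ y ∈ s, x < y
    · obtain ⟨a, ha, hamax⟩ := (s.filter (· < x)).exists_max_image id
        (by obtain ⟨y, hy⟩ := hlo; exact ⟨y, by simpa using hy⟩)
      obtain ⟨b, hb, hbmin⟩ := (s.filter (x < ·)).exists_min_image id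
        (by obtain ⟨y, hy⟩ := hhi; exact ⟨y, by simpa using hy⟩)
      simp only [Finset.mem_filter, id, and_imp] at ha hb hamax hbmin
      obtain ⟨ha, hax⟩ := ha
      obtain ⟨hb, hxb⟩ := hb
      have hgap : ∀ w ∈ s, w ≤ a ∨ b ≤ w := by
        intro w hw
        rcases lt_trichotomy w x with h | rfl | h
        · exact Or.inl (hamax w hw h)
        · exact absurd hw hx
        · exact Or.inr (hbmin w hw h)
      have hgap' : ∀ y ∈ s, y ∉ Set.Ioo a b := fun y hy hyab =>
        (hgap y hy).elim hyab.1.not_ge hyab.2.not_ge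
      have hmem : (b - a) ^ 2 / 8 ∈ decrements s :=
        Or.inl (Or.inl ⟨a, ha, b, hb, hax.trans hxb, hgap', rfl⟩)
      have hF := F1_insert_internal hs ha hb hax.le hxb.le hgap
      have hle := hub _ hmem
      have hmid : x - (a + b) / 2 = 0 := pow_eq_zero_iff two_ne_zero |>.1
        (le_antisymm (by nlinarith) (sq_nonneg _))
      have hval : F1 s - F1 (insert x s) = (b - a) ^ 2 / 8 := by
        rw [hF, sub_eq_zero.1 hmid]; ring
      have hM := hmax _ hmem hval
      exact ⟨Or.inl ⟨a, ha, b, hb, hax.trans hxb, hgap', sub_eq_zero.1 hmid, hM⟩, by linarith⟩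
    · have hall : ∀ y ∈ s, y ≤ x := fun y hy => not_lt.1 fun h => hhi ⟨y, hy, h⟩
      obtain ⟨b, hb, hbmax⟩ := s.exists_max_image id hne
      have hmem : (1 - b) ^ 2 / 3 ∈ decrements s := Or.inr ⟨b, hb, hbmax, rfl⟩
      have hF := F1_insert_right hs hb (hall b hb) hx1 hbmax
      have hle := hub _ hmem
      have hopt : x - (2 + b) / 3 = 0 := pow_eq_zero_iff two_ne_zero |>.1
        (le_antisymm (by linarith) (sq_nonneg _))
      have hval : F1 s - F1 (insert x s) = (1 - b) ^ 2 / 3 := by rw [hF, hopt]; ring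
      have hM := hmax _ hmem hval
      exact ⟨Or.inr (Or.inr ⟨b, hb, hbmax, sub_eq_zero.1 hopt, hM⟩), by linarith⟩
  · have hall : ∀ y ∈ s, x ≤ y := fun y hy => not_lt.1 fun h => hlo ⟨y, hy, h⟩
    obtain ⟨a, ha, hamin⟩ := s.exists_min_image id hne
    have hmem : a ^ 2 / 3 ∈ decrements s := Or.inl (Or.inr ⟨a, ha, hamin, rfl⟩)
    have hF := F1_insert_left hs ha hx0 (hall a ha) hamin
    have hle := hub _ hmem
    have hopt : x - a / 3 = 0 := pow_eq_zero_iff two_ne_zero |>.1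
      (le_antisymm (by linarith) (sq_nonneg _))
    have hval : F1 s - F1 (insert x s) = a ^ 2 / 3 := by rw [hF, hopt]; ring
    have hM := hmax _ hmem hval
    exact ⟨Or.inr (Or.inl ⟨a, ha, hamin, sub_eq_zero.1 hopt, hM⟩), by linarith⟩
end
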